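/- Let p be a prime, F a field of characteristic p, and K/F a purely inseparable field extension with K^p ⊆ F. Then the composite group homomorphism Frob_{K/F} ∘ r_{K/F} : Br_p(F) → Br_p(F) is trivial; that is, for every central simple F-algebra A of exponent dividing p, the F-algebra Frob_{K/F}(A ⊗_F K) is split. -/

import Mathlib

open scoped TensorProduct

/-- A finite-dimensional central simple algebra over a field `F`. -/
def IsCSA (F A : Type) [Field F] [Ring A] [Algebra F A] : Prop :=
  Algebra.IsCentral F A ∧ IsSimpleRing A ∧ FiniteDimensional F A

/-- An `F`-algebra is split if it is isomorphic to a matrix algebra over `F`. -/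
def IsSplitAlg (F A : Type) [Field F] [Ring A] [Algebra F A] : Prop :=
  ∃ n : ℕ, 0 < n ∧ Nonempty (A ≃ₐ[F] Matrix (Fin n) (Fin n) F)

/-- Brauer equivalence of two algebras over a field `F`. -/
def IsBrauerEquiv (F A B : Type) [Field F] [Ring A] [Algebra F A] [Ring B] [Algebra F B] :
    Prop :=
  ∃ n m : ℕ, 0 < n ∧ 0 < m ∧
    Nonempty ((Matrix (Fin n) (Fin n) A) ≃ₐ[F] (Matrix (Fin m) (Fin m) B))

/-- `A` has exponent `e`: `e` is the least positive integer such that the `e`-fold tensor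
power of `A` over `F` is split. -/
def HasExponent (F A : Type) [Field F] [Ring A] [Algebra F A] (e : ℕ) : Prop :=
  0 < e ∧ IsSplitAlg F (⨂[F] _ : Fin e, A) ∧
    ∀ k : ℕ, 0 < k → IsSplitAlg F (⨂[F] _ : Fin k, A) → e ≤ k

/-- `A` has (Schur) index `d`: `A` is isomorphic to a matrix algebra over a division
algebra of dimension `d ^ 2` over `F`. -/
def HasIndex (F A : Type) [Field F] [Ring A] [Algebra F A] (d : ℕ) : Prop :=
  ∃ (D : Type) (_ : DivisionRing D) (_ : Algebra F D) (m : ℕ), 0 < m ∧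
    Nonempty (A ≃ₐ[F] Matrix (Fin m) (Fin m) D) ∧ Module.finrank F D = d ^ 2

/-- The (Schur) index of `A` is at most `d`. -/
def IndexLE (F A : Type) [Field F] [Ring A] [Algebra F A] (d : ℕ) : Prop :=
  ∃ e : ℕ, e ≤ d ∧ HasIndex F A e

/-- `A` is the cyclic (symbol) algebra `[a, b)_{p,F}` of degree `p` in characteristic `p`:
it has dimension `p ^ 2` over `F` and is generated by elements `i`, `j` subject to
`i ^ p - i = a`, `j ^ p = b`, `j * i = (i - 1) * j`. -/
def IsCyclicAlgWith (p : ℕ) (F A : Type) [Field F] [Ring A] [Algebra F A] (a b : F) : Prop :=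
  b ≠ 0 ∧ Module.finrank F A = p ^ 2 ∧
    ∃ i j : A, i ^ p - i = algebraMap F A a ∧ j ^ p = algebraMap F A b ∧
      j * i = (i - 1) * j ∧ Algebra.adjoin F {i, j} = ⊤

/-- `A` is a cyclic algebra of degree `p`, i.e. of the form `[a, b)_{p,F}`. -/
def IsCyclicPAlg (p : ℕ) (F A : Type) [Field F] [Ring A] [Algebra F A] : Prop :=
  ∃ a b : F, IsCyclicAlgWith p F A a b

/-- The `p`-symbol length of `A` is at most `m`: `A` is Brauer equivalent to a tensor
product of at most `m` cyclic `F`-algebras of degree `p`. -/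
def SymbolLengthLE (p : ℕ) (F A : Type) [Field F] [Ring A] [Algebra F A] (m : ℕ) : Prop :=
  ∃ k : ℕ, k ≤ m ∧ ∃ (D : Fin k → Type) (_ : ∀ i, Ring (D i)) (_ : ∀ i, Algebra F (D i)),
    (∀ i, IsCyclicPAlg p F (D i)) ∧ IsBrauerEquiv F A (⨂[F] i, D i)

/-- `M` is a compositum `LK` of `L` and `K` over `F`: it is generated as an `F`-algebra by
the images of `L` and `K`. -/
def IsCompositum (F L K M : Type) [Field F] [Field L] [Field K] [Field M]
    [Algebra F L] [Algebra F K] [Algebra F M] [Algebra L M] [Algebra K M]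
    [IsScalarTower F L M] [IsScalarTower F K M] : Prop :=
  (IsScalarTower.toAlgHom F L M).range ⊔ (IsScalarTower.toAlgHom F K M).range = ⊤

/-- A cyclic algebra of degree `m` over `F`: a central simple `F`-algebra of degree `m`
containing a cyclic field extension of `F` of degree `m` (as a maximal subfield). -/
def IsCyclicAlgebra (F A : Type) [Field F] [Ring A] [Algebra F A] (m : ℕ) : Prop :=
  IsCSA F A ∧ Module.finrank F A = m ^ 2 ∧
  ∃ (L : Type) (_ : Field L) (_ : Algebra F L), IsGalois F L ∧ IsCyclic (L ≃ₐ[F] L) ∧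
    Module.finrank F L = m ∧ Nonempty (L →ₐ[F] A)

/-- `L/F` is a `p`-extension: there is a tower of intermediate fields from `F` to `L`
each step of which is a cyclic extension of degree `p`. -/
def IsPExtension (p : ℕ) (F L : Type) [Field F] [Field L] [Algebra F L] : Prop :=
  ∃ (n : ℕ) (T : Fin (n + 1) → IntermediateField F L),
    T 0 = ⊥ ∧ T (Fin.last n) = ⊤ ∧
    ∀ i : Fin n, ∃ h : T i.castSucc ≤ T i.succ,
      IsGalois (T i.castSucc) (IntermediateField.extendScalars h) ∧
      IsCyclic ((IntermediateField.extendScalars h) ≃ₐ[T i.castSucc]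
        (IntermediateField.extendScalars h)) ∧
      Module.finrank (T i.castSucc) (IntermediateField.extendScalars h) = p

/-- `F` is `p`-cyclic reducible: for every central simple `F`-algebra `A` of exponent `p`
and every purely inseparable extension `K/F` with `K ^ p ⊆ F`, either `A_K` is split, or
there is a separable extension `L/F` of degree `ind (A_K) / p` such that `A_{LK}` is
Brauer equivalent to a cyclic `LK`-algebra of degree `p`. -/
def IsPCyclicReducible (p : ℕ) (F : Type) [Field F] : Prop :=
  ∀ (A : Type) [Ring A] [Algebra F A], IsCSA F A → HasExponent F A p →
  ∀ (K : Type) [Field K] [Algebra F K], IsPurelyInseparable F K →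
    (∀ z : K, z ^ p ∈ (algebraMap F K).range) →
    IsSplitAlg K (K ⊗[F] A) ∨
    ∃ d : ℕ, HasIndex K (K ⊗[F] A) (p * d) ∧
      ∃ (L : Type) (_ : Field L) (_ : Algebra F L), Algebra.IsSeparable F L ∧
        Module.finrank F L = d ∧
        ∃ (M : Type) (_ : Field M) (_ : Algebra F M) (_ : Algebra L M) (_ : Algebra K M)
          (_ : IsScalarTower F L M) (_ : IsScalarTower F K M),
          IsCompositum F L K M ∧
          ∃ (C : Type) (_ : Ring C) (_ : Algebra M C),
            IsCyclicPAlg p M C ∧ IsBrauerEquiv M (M ⊗[F] A) C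

/-- `F` is `p`-reducible: for every central simple `F`-algebra `A` of exponent `p`
and every purely inseparable extension `K/F` with `K ^ p ⊆ F`, either `A_K` is split, or
there is a separable extension `L/F` of degree `ind (A_K) / p` with `ind A_{LK} = p`. -/
def IsPReducible (p : ℕ) (F : Type) [Field F] : Prop :=
  ∀ (A : Type) [Ring A] [Algebra F A], IsCSA F A → HasExponent F A p →
  ∀ (K : Type) [Field K] [Algebra F K], IsPurelyInseparable F K →
    (∀ z : K, z ^ p ∈ (algebraMap F K).range) →
    IsSplitAlg K (K ⊗[F] A) ∨
    ∃ d : ℕ, HasIndex K (K ⊗[F] A) (p * d) ∧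
      ∃ (L : Type) (_ : Field L) (_ : Algebra F L), Algebra.IsSeparable F L ∧
        Module.finrank F L = d ∧
        ∃ (M : Type) (_ : Field M) (_ : Algebra F M) (_ : Algebra L M) (_ : Algebra K M)
          (_ : IsScalarTower F L M) (_ : IsScalarTower F K M),
          IsCompositum F L K M ∧ HasIndex M (M ⊗[F] A) p

universe u

/-- In a simple ring, the unit lies in the two-sided ideal generated by a nonzero element. -/
theorem IsSimpleRing.exists_sum_mul_mul_eq_one {B : Type*} [Ring B] [IsSimpleRing B] {e : B}
    (he : e ≠ 0) : ∃ (s : Finset (B × B)) (b c : B × B → B), ∑ i ∈ s, b i * e * c i = 1 := by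
  have h1 := IsSimpleRing.one_mem_of_ne_zero_mem (TwoSidedIdeal.span {e}) he
    (TwoSidedIdeal.subset_span rfl)
  rw [TwoSidedIdeal.mem_span_iff_mem_addSubgroup_closure] at h1
  have h2 : (1 : B) ∈ Submodule.span ℤ (Set.range fun q : B × B => q.1 * e * q.2) := by
    refine (AddSubgroup.closure_le (Submodule.span ℤ
      (Set.range fun q : B × B => q.1 * e * q.2)).toAddSubgroup).2 ?_ h1
    rintro _ ⟨_, ⟨x, -, _, rfl, rfl⟩, y, -, rfl⟩
    exact Submodule.subset_span ⟨(x, y), rfl⟩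
  obtain ⟨c, hc⟩ := Finsupp.mem_span_range_iff_exists_finsupp.1 h2
  exact ⟨c.support, fun q => c q • q.1, Prod.snd, by simpa [Finsupp.sum, mul_assoc] using hc⟩

/-- In a central simple algebra, a commutative corner ring is one-dimensional. -/
theorem exists_smul_eq_of_commutative_corner {F B : Type*} [Field F] [Ring B] [Algebra F B]
    [Algebra.IsCentral F B] [IsSimpleRing B] {e : B} (he : IsIdempotentElem e) (he0 : e ≠ 0)
    (hcomm : ∀ x y : B, (e * x * e) * (e * y * e) = (e * y * e) * (e * x * e)) (x : B) :
    ∃ r : F, e * x * e = r • e := by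
  obtain ⟨s, b, c, hbc⟩ := IsSimpleRing.exists_sum_mul_mul_eq_one he0
  have hee (t : B) : e * (e * t) = e * t := by rw [← mul_assoc, he]
  have hcomm' (x y t : B) : e * (x * (e * (y * (e * t)))) = e * (y * (e * (x * (e * t)))) := by
    simpa [mul_assoc, hee] using congrArg (· * t) (hcomm x y)
  have hcomm'' (x y : B) : e * (x * (e * (y * e))) = e * (y * (e * (x * e))) := by
    simpa [mul_assoc, hee] using hcomm x y
  simp only [mul_assoc] at hbc
  set w := ∑ i ∈ s, b i * (e * (x * (e * c i))) with hw
  have hcen : w ∈ Subalgebra.center F B := by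
    rw [Subalgebra.mem_center_iff]
    intro t
    calc t * w = (∑ j ∈ s, b j * (e * c j)) * (t * w) := by rw [hbc, one_mul]
      _ = ∑ j ∈ s, ∑ i ∈ s, b j * (e * (c j * (t * (b i * (e * (x * (e * c i))))))) := by
        simp only [hw, Finset.mul_sum, Finset.sum_mul, mul_assoc]
        rw [Finset.sum_comm]
      _ = ∑ j ∈ s, ∑ i ∈ s, b j * (e * (x * (e * (c j * (t * (b i * (e * c i))))))) := by
        refine Finset.sum_congr rfl fun j _ => Finset.sum_congr rfl fun i _ => ?_
        have := hcomm' (c j * t * b i) x (c i)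
        simp only [mul_assoc] at this
        rw [this]
      _ = w * (t * ∑ i ∈ s, b i * (e * c i)) := by
        simp only [hw, Finset.mul_sum, Finset.sum_mul, mul_assoc]
        rw [Finset.sum_comm]
      _ = w * t := by rw [hbc, mul_one]
  obtain ⟨r, hr⟩ := Algebra.mem_bot.1 (Algebra.IsCentral.out hcen)
  refine ⟨r, ?_⟩
  calc e * x * e = (∑ i ∈ s, b i * (e * c i)) * (e * (x * e)) := by rw [hbc, one_mul, mul_assoc]
    _ = ∑ i ∈ s, b i * (e * (x * (e * (c i * e)))) := by
      rw [Finset.sum_mul]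
      refine Finset.sum_congr rfl fun i _ => ?_
      rw [hcomm'' x (c i)]
      simp only [mul_assoc]
    _ = w * e := by simp only [hw, Finset.sum_mul, mul_assoc]
    _ = r • e := by rw [← hr, Algebra.smul_def]

/-- A finite-dimensional central simple algebra with a nonzero commutative corner is split. -/
theorem isSplitAlg_of_commutative_corner {F B : Type} [Field F] [Ring B] [Algebra F B]
    [Algebra.IsCentral F B] [IsSimpleRing B] [FiniteDimensional F B] {e : B}
    (he : IsIdempotentElem e) (he0 : e ≠ 0)
    (hcomm : ∀ x y : B, (e * x * e) * (e * y * e) = (e * y * e) * (e * x * e)) :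
    IsSplitAlg F B := by
  obtain ⟨s, b, c, hbc⟩ := IsSimpleRing.exists_sum_mul_mul_eq_one he0
  let M : Ideal B := Ideal.span {e}
  have hMe (y : M) : (y : B) * e = y := by
    obtain ⟨a, ha⟩ := Ideal.mem_span_singleton'.1 y.2
    rw [← ha, mul_assoc, he]
  have heM : e ∈ M := Ideal.subset_span rfl
  have : FiniteDimensional F M := inferInstanceAs (FiniteDimensional F (M.restrictScalars F))
  have : Nontrivial M := ⟨⟨⟨e, heM⟩, 0, fun h => he0 (congrArg Subtype.val h)⟩⟩
  have hsurj : Function.Surjective (Algebra.lsmul F F M : B →ₐ[F] Module.End F M) := by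
    intro f
    refine ⟨∑ i ∈ s, (f ⟨b i * e, M.mul_mem_left _ heM⟩ : B) * c i, ?_⟩
    ext y
    choose r hr using fun i =>
      exists_smul_eq_of_commutative_corner (F := F) he he0 hcomm (c i * y)
    have hr' (i) : e * (c i * y) = r i • e := by
      rw [← hr, mul_assoc, mul_assoc, hMe]
    have hy : y = ∑ i ∈ s, r i • (⟨b i * e, M.mul_mem_left _ heM⟩ : M) := by
      apply Subtype.ext
      rw [← one_mul (y : B), ← hbc, Finset.sum_mul, AddSubmonoidClass.coe_finsetSum]
      refine Finset.sum_congr rfl fun i _ => ?_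
      rw [mul_assoc, mul_assoc, hr', Submodule.coe_smul_of_tower, mul_smul_comm]
    have hfy : f y = ∑ i ∈ s, r i • f ⟨b i * e, M.mul_mem_left _ heM⟩ := by
      conv_lhs => rw [hy]
      simp only [map_sum, map_smul]
    rw [hfy, AddSubmonoidClass.coe_finsetSum, Algebra.lsmul_coe, Submodule.coe_smul, smul_eq_mul,
      Finset.sum_mul]
    refine Finset.sum_congr rfl fun i _ => ?_
    rw [Submodule.coe_smul_of_tower, ← hMe (f _), mul_assoc, mul_assoc, hr', mul_smul_comm]
  have hinj : Function.Injective (Algebra.lsmul F F M : B →ₐ[F] Module.End F M) :=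
    (Algebra.lsmul F F M : B →ₐ[F] Module.End F M).toRingHom.injective
  exact ⟨Module.finrank F M, Module.finrank_pos,
    ⟨(AlgEquiv.ofBijective _ ⟨hinj, hsurj⟩).trans
      (algEquivMatrix (Module.finBasis F M))⟩⟩

/-- In characteristic `p`, the sum of a function invariant under a permutation of order
dividing `p` is the sum over the fixed points. -/
theorem sum_eq_sum_fixedPoints {X R : Type*} [Fintype X] [DecidableEq X] [CommRing R] (p : ℕ)
    [Fact p.Prime] [CharP R p] (σ : Equiv.Perm X) (hσ : σ ^ p = 1) (h : X → R)
    (hh : ∀ x, h (σ x) = h x) : ∑ x, h x = ∑ x with σ x = x, h x := by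
  classical
  rw [← Finset.sum_fiberwise_of_maps_to (g := h) (t := Finset.univ.image h) (by simp),
    ← Finset.sum_fiberwise_of_maps_to (s := {x | σ x = x}) (g := h) (t := Finset.univ.image h)
      (by simp)]
  refine Finset.sum_congr rfl fun v _ => ?_
  rw [Finset.sum_congr rfl (g := fun _ => v) (by simp),
    Finset.sum_congr rfl (s₁ := Finset.filter _ (Finset.filter _ _)) (g := fun _ => v) (by simp),
    Finset.sum_const, Finset.sum_const, nsmul_eq_mul, nsmul_eq_mul]
  congr 1
  rw [CharP.natCast_eq_natCast R p]
  let τ : Equiv.Perm {x // h x = v} := σ.subtypePerm fun x => by rw [hh]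
  have hτ : τ ^ p ^ 1 = 1 := by
    rw [pow_one, Equiv.Perm.subtypePerm_pow]
    ext x
    simp [hσ]
  have key := Equiv.Perm.card_compl_support_modEq hτ
  rw [Fintype.card_subtype] at key
  refine key.symm.trans (congrArg (· % p) ?_)
  refine Finset.card_bij (fun x _ => x.1) ?_ (fun _ _ _ _ => Subtype.ext) ?_
  · intro x hx
    simpa [τ, Subtype.ext_iff, x.2] using hx
  · intro x hx
    simp only [Finset.mem_filter, Finset.mem_univ, true_and] at hx
    exact ⟨⟨x, hx.2⟩, by simp [τ, hx.1], rfl⟩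

/-- A finitely generated torsion module over a principal ideal domain is a direct sum of cyclic
modules, expressed through idempotent endomorphisms with commutative corners. -/
theorem exists_idempotents_commutative_corner {R : Type u} {M : Type*} [CommRing R] [IsDomain R]
    [IsPrincipalIdealRing R] [AddCommGroup M] [Module R M] [Module.Finite R M]
    (hM : Module.IsTorsion R M) :
    ∃ (ι : Type u) (_ : Fintype ι) (e : ι → Module.End R M), ∑ i, e i = 1 ∧
      (∀ i, IsIdempotentElem (e i)) ∧
      ∀ i x y, (e i * x * e i) * (e i * y * e i) = (e i * y * e i) * (e i * x * e i) := by
  classical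
  obtain ⟨ι, _, q, -, n, ⟨Φ⟩⟩ := Module.equiv_directSum_of_isTorsion hM
  let inc (i : ι) : (R ⧸ R ∙ q i ^ n i) →ₗ[R] M :=
    Φ.symm.toLinearMap ∘ₗ DirectSum.lof R ι (fun i => R ⧸ R ∙ q i ^ n i) i
  let prj (i : ι) : M →ₗ[R] (R ⧸ R ∙ q i ^ n i) :=
    DirectSum.component R ι (fun i => R ⧸ R ∙ q i ^ n i) i ∘ₗ Φ.toLinearMap
  have hpi (i) (z) : prj i (inc i z) = z := by simp [inc, prj, DirectSum.component.lof_self]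
  have hcyc (i : ι) (f g : Module.End R (R ⧸ R ∙ q i ^ n i)) (z) : f (g z) = g (f z) := by
    have aux (f : Module.End R (R ⧸ R ∙ q i ^ n i)) : ∃ r : R, ∀ z, f z = r • z := by
      obtain ⟨r, hr⟩ := Submodule.Quotient.mk_surjective _ (f (Submodule.Quotient.mk 1))
      refine ⟨r, fun z => ?_⟩
      obtain ⟨z, rfl⟩ := Submodule.Quotient.mk_surjective _ z
      have hz : (Submodule.Quotient.mk z : R ⧸ R ∙ q i ^ n i) = z • Submodule.Quotient.mk 1 := by
        rw [← Submodule.Quotient.mk_smul, smul_eq_mul, mul_one]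
      rw [hz, map_smul, ← hr, ← Submodule.Quotient.mk_smul, ← Submodule.Quotient.mk_smul,
        ← Submodule.Quotient.mk_smul, smul_eq_mul, smul_eq_mul, smul_eq_mul, mul_one, mul_comm]
    obtain ⟨r, hr⟩ := aux f
    obtain ⟨t, ht⟩ := aux g
    rw [hr, ht, hr, ht, smul_comm]
  refine ⟨ι, inferInstance, fun i => inc i ∘ₗ prj i, ?_, fun i => ?_, fun i x y => ?_⟩
  · ext m
    apply Φ.injective
    simp only [LinearMap.sum_apply, LinearMap.comp_apply, Module.End.one_apply, map_sum, inc, prj,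
      LinearEquiv.coe_coe, LinearEquiv.apply_symm_apply]
    exact DirectSum.sum_univ_of (Φ m)
  · ext m
    simp [Module.End.mul_apply, hpi]
  · ext m
    simp only [Module.End.mul_apply, LinearMap.comp_apply, hpi]
    exact congrArg (inc i) (hcyc i (prj i ∘ₗ x ∘ₗ inc i) (prj i ∘ₗ y ∘ₗ inc i) (prj i m))

section BaseChange

variable {k L A : Type*} [Field k] [Field L] [Algebra k L] [Ring A] [Algebra k A]

open TensorProduct

theorem equivFinsuppOfBasisLeft_one_tmul_mul {ι : Type*} [DecidableEq ι]
    (b : Module.Basis ι k L) (a : A) (x : L ⊗[k] A)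
    (j : ι) : equivFinsuppOfBasisLeft b ((1 ⊗ₜ a) * x) j = a * equivFinsuppOfBasisLeft b x j := by
  induction x with
  | zero => simp
  | tmul l n => simp
  | add x y hx hy => simp [mul_add, hx, hy]

theorem equivFinsuppOfBasisLeft_mul_one_tmul {ι : Type*} [DecidableEq ι]
    (b : Module.Basis ι k L) (a : A) (x : L ⊗[k] A)
    (j : ι) : equivFinsuppOfBasisLeft b (x * (1 ⊗ₜ a)) j = equivFinsuppOfBasisLeft b x j * a := by
  induction x with
  | zero => simp
  | tmul l n => simp
  | add x y hx hy => simp [add_mul, hx, hy]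

/-- The centralizer of `A` in `L ⊗ A` is `L` when `A` is central. -/
theorem exists_eq_tmul_one_of_commute [Algebra.IsCentral k A] (x : L ⊗[k] A)
    (hx : ∀ a : A, (1 ⊗ₜ a) * x = x * (1 ⊗ₜ a)) : ∃ l : L, x = l ⊗ₜ 1 := by
  classical
  let b := Module.Free.chooseBasis k L
  have hc (j) : ∃ r : k, equivFinsuppOfBasisLeft b x j = algebraMap k A r := by
    have : equivFinsuppOfBasisLeft b x j ∈ Subalgebra.center k A := by
      rw [Subalgebra.mem_center_iff]
      intro a
      rw [← equivFinsuppOfBasisLeft_one_tmul_mul, hx, equivFinsuppOfBasisLeft_mul_one_tmul]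
    obtain ⟨r, hr⟩ := Algebra.mem_bot.1 (Algebra.IsCentral.out this)
    exact ⟨r, hr.symm⟩
  choose r hr using hc
  refine ⟨∑ j ∈ (equivFinsuppOfBasisLeft b x).support, r j • b j, ?_⟩
  conv_lhs => rw [← (equivFinsuppOfBasisLeft b).symm_apply_apply x,
    equivFinsuppOfBasisLeft_symm_apply, Finsupp.sum]
  rw [sum_tmul]
  refine Finset.sum_congr rfl fun j _ => ?_
  rw [hr, Algebra.algebraMap_eq_smul_one, tmul_smul, smul_tmul']

theorem isCentral_baseChange [Algebra.IsCentral k A] : Algebra.IsCentral L (L ⊗[k] A) where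
  out x hx := by
    obtain ⟨l, rfl⟩ := exists_eq_tmul_one_of_commute x fun a =>
      Subalgebra.mem_center_iff.1 hx (1 ⊗ₜ a)
    exact ⟨l, rfl⟩

theorem isSimpleRing_baseChange [Algebra.IsCentral k A] [IsSimpleRing A] :
    IsSimpleRing (L ⊗[k] A) := by
  have : Nontrivial (L ⊗[k] A) :=
    (Algebra.TensorProduct.includeRight_injective (R := k) (A := L) (B := A)
      (algebraMap k L).injective).nontrivial
  refine .of_eq_bot_or_eq_top fun I => or_iff_not_imp_left.2 fun hI => ?_
  classical
  let b := Module.Free.chooseBasis k L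
  let Φ := equivFinsuppOfBasisLeft (N := A) b
  obtain ⟨x₀, hx₀, hx₀0⟩ := SetLike.exists_of_lt (bot_lt_iff_ne_bot.mpr hI)
  obtain ⟨x, ⟨hxI, hx0⟩, hmin⟩ := (measure fun x => (Φ x).support.card).wf.has_min
    {x | x ∈ I ∧ x ≠ 0} ⟨x₀, hx₀, hx₀0⟩
  obtain ⟨j₀, hj₀⟩ : ∃ j, Φ x j ≠ 0 := by
    by_contra! h
    exact hx0 (Φ.injective (by rw [map_zero]; exact Finsupp.ext h))
  obtain ⟨s, β, γ, hs⟩ := IsSimpleRing.exists_sum_mul_mul_eq_one hj₀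
  let y : L ⊗[k] A := ∑ i ∈ s, (1 ⊗ₜ β i) * x * (1 ⊗ₜ γ i)
  have hyI : y ∈ I := sum_mem fun i _ => I.mul_mem_right _ _ (I.mul_mem_left _ _ hxI)
  have hy (j) : Φ y j = ∑ i ∈ s, β i * Φ x j * γ i := by
    simp only [y, map_sum, Finsupp.finsetSum_apply]
    refine Finset.sum_congr rfl fun i _ => ?_
    rw [equivFinsuppOfBasisLeft_mul_one_tmul, equivFinsuppOfBasisLeft_one_tmul_mul]
  have hcomm (a : A) : (1 ⊗ₜ a) * y = y * (1 ⊗ₜ a) := by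
    by_contra hne
    refine hmin ((1 ⊗ₜ a) * y - y * (1 ⊗ₜ a))
      ⟨I.sub_mem (I.mul_mem_left _ _ hyI) (I.mul_mem_right _ _ hyI), sub_ne_zero.2 hne⟩ ?_
    have hz (j) : Φ ((1 ⊗ₜ a) * y - y * (1 ⊗ₜ a)) j = a * Φ y j - Φ y j * a := by
      rw [map_sub, Finsupp.sub_apply, equivFinsuppOfBasisLeft_mul_one_tmul,
        equivFinsuppOfBasisLeft_one_tmul_mul]
    refine Finset.card_lt_card (Finset.ssubset_iff_of_subset ?_ |>.2 ⟨j₀, ?_, ?_⟩)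
    · intro j hj
      rw [Finsupp.mem_support_iff, hz] at hj
      rw [Finsupp.mem_support_iff]
      intro h
      simp [hy, h] at hj
    · simpa using hj₀
    · rw [Finsupp.notMem_support_iff, hz, hy, hs, mul_one, one_mul, sub_self]
  obtain ⟨l, hl⟩ := exists_eq_tmul_one_of_commute y hcomm
  have hl0 : l ≠ 0 := by
    rintro rfl
    have h := hy j₀
    rw [hs, hl, zero_tmul, map_zero, Finsupp.zero_apply] at h
    exact zero_ne_one h
  rw [← I.one_mem_iff]
  have := I.mul_mem_left (l⁻¹ ⊗ₜ 1) _ hyI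
  rwa [hl, Algebra.TensorProduct.tmul_mul_tmul, inv_mul_cancel₀ hl0, mul_one,
    ← Algebra.TensorProduct.one_def] at this

end BaseChange

open Polynomial in
/-- Endomorphisms of the `F[X]`-module attached to `u` are the endomorphisms commuting
with `u`. -/
theorem exists_surjective_end_aeval_centralizer {F V : Type*} [Field F] [AddCommGroup V]
    [Module F V] (u : Module.End F V) :
    ∃ f : Module.End F[X] (Module.AEval' u) →+* Subalgebra.centralizer F {u},
      Function.Surjective f := by
  let of := Module.AEval'.of u
  refine ⟨⟨⟨⟨fun g => ⟨of.symm.toLinearMap ∘ₗ g.restrictScalars F ∘ₗ of.toLinearMap, ?_⟩, ?_⟩,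
    ?_⟩, ?_, ?_⟩, ?_⟩
  · rw [Subalgebra.mem_centralizer_iff]
    intro w hw
    rw [Set.mem_singleton_iff.1 hw]
    ext v
    change u (of.symm (g (of v))) = of.symm (g (of (u v)))
    have h1 : of (u v) = (X : F[X]) • of v := (Module.AEval.X_smul_of u v).symm
    rw [h1, map_smul]
    exact (Module.AEval.of_symm_X_smul u _).symm
  · rfl
  · intro g h
    rfl
  · rfl
  · intro g h
    rfl
  · rintro ⟨s, hs⟩
    refine ⟨LinearMap.ofAEval u (of.toLinearMap ∘ₗ s) fun v => ?_, ?_⟩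
    · have h := (Subalgebra.mem_centralizer_iff F).1 hs u rfl
      have h' : s (u v) = u (s v) := (LinearMap.congr_fun h v).symm
      change of (s (u v)) = (X : F[X]) • of (s v)
      rw [h']
      exact (Module.AEval.X_smul_of u _).symm
    · rfl

/-- A central simple quotient of the centralizer of an endomorphism is split. -/
theorem isSplitAlg_of_surjective_centralizer {F B V : Type} [Field F] [Ring B] [Algebra F B]
    [Algebra.IsCentral F B] [IsSimpleRing B] [AddCommGroup V] [Module F V]
    [FiniteDimensional F V] (u : Module.End F V) (π : Subalgebra.centralizer F {u} →ₐ[F] B)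
    (hπ : Function.Surjective π) : IsSplitAlg F B := by
  have : FiniteDimensional F B := Module.Finite.of_surjective π.toLinearMap hπ
  obtain ⟨f, hf⟩ := exists_surjective_end_aeval_centralizer u
  obtain ⟨ι, _, e, hsum, hidem, hcomm⟩ := exists_idempotents_commutative_corner
    (Module.AEval.isTorsion_of_finiteDimensional F V u)
  let ψ : Module.End (Polynomial F) (Module.AEval' u) →+* B := (π : _ →+* B).comp f
  have hψ : Function.Surjective ψ := hπ.comp hf
  obtain ⟨i, hi⟩ : ∃ i, ψ (e i) ≠ 0 := by
    by_contra! h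
    have h1 := congrArg ψ hsum
    simp [h] at h1
  refine isSplitAlg_of_commutative_corner ((hidem i).map ψ) hi fun x y => ?_
  obtain ⟨x, rfl⟩ := hψ x
  obtain ⟨y, rfl⟩ := hψ y
  simp only [← map_mul, hcomm]

section FinRotate

variable {p : ℕ} {ι : Type*}

theorem finRotate_pow_self : finRotate p ^ p = 1 := by
  match p with
  | 0 => rfl
  | 1 => exact Subsingleton.elim _ _
  | n + 2 =>
    have h : orderOf (finRotate (n + 2)) = n + 2 := by
      rw [← Equiv.Perm.lcm_cycleType, cycleType_finRotate]
      simp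
    exact orderOf_dvd_iff_pow_eq_one.1 h.dvd

theorem eq_apply_of_comp_finRotate_eq {f : Fin p → ι} (hf : ∀ i, f (finRotate p i) = f i)
    (i j : Fin p) : f i = f j := by
  match p with
  | 0 => exact i.elim0
  | n + 1 =>
    have h0 (k : Fin (n + 1)) : f k = f 0 := by
      induction k using Fin.induction with
      | zero => rfl
      | succ k ih => rw [← ih, ← hf k.castSucc, finRotate_apply, Fin.coeSucc_eq_succ]
    rw [h0 i, h0 j]

/-- In characteristic `p`, the sum of a rotation-invariant function of `p` variables is the sum
of its values on the diagonal. -/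
theorem sum_pi_eq_sum_const [Fact p.Prime] [Fintype ι] {R : Type*} [CommRing R] [CharP R p]
    (h : (Fin p → ι) → R) (hh : ∀ f, h (f ∘ finRotate p) = h f) :
    ∑ f, h f = ∑ i, h fun _ => i := by
  classical
  let P : Equiv.Perm (Fin p → ι) := Equiv.arrowCongr (finRotate p).symm (Equiv.refl ι)
  have hP (f) : P f = f ∘ finRotate p := rfl
  have hPn (n : ℕ) (f) : (P ^ n) f = f ∘ ⇑(finRotate p ^ n) := by
    induction n generalizing f with
    | zero => rfl
    | succ n ih => rw [pow_succ, Equiv.Perm.mul_apply, ih, hP, pow_succ']; rfl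
  have hPp : P ^ p = 1 := by
    ext f i
    rw [hPn, finRotate_pow_self]
    rfl
  rw [sum_eq_sum_fixedPoints p P hPp h hh]
  have hpos : 0 < p := (Fact.out : p.Prime).pos
  refine (Finset.sum_bij (fun i _ _ => i) (fun i _ => ?_) (fun i _ j _ hij => ?_)
    (fun f hf => ?_) fun _ _ => rfl).symm
  · simp [hP, Function.comp_def]
  · exact congrFun hij ⟨0, hpos⟩
  · simp only [Finset.mem_filter, Finset.mem_univ, true_and, hP] at hf
    exact ⟨f ⟨0, hpos⟩, Finset.mem_univ _,
      funext fun i => eq_apply_of_comp_finRotate_eq (congrFun hf) _ _⟩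

end FinRotate

section FrobeniusTwist

open PiTensorProduct

variable (p : ℕ) {F A B ι : Type*} [Field F] [Ring A] [Algebra F A] [Ring B] [Algebra F B]

variable (F A) in
/-- Cyclic permutation of the factors of a tensor power, as an algebra automorphism. -/
noncomputable def rotateTensorPower : (⨂[F] _ : Fin p, A) ≃ₐ[F] (⨂[F] _ : Fin p, A) :=
  AlgEquiv.ofLinearEquiv (PiTensorProduct.reindex F (fun _ : Fin p => A) (finRotate p))
    (by rw [one_def]; exact reindex_tprod _ _)
    (fun x y => by
      induction x using PiTensorProduct.induction_on with
      | add x₁ x₂ h₁ h₂ => simp only [add_mul, map_add, h₁, h₂]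
      | smul_tprod r f =>
        induction y using PiTensorProduct.induction_on with
        | add y₁ y₂ h₁ h₂ => simp only [mul_add, map_add, h₁, h₂]
        | smul_tprod s g =>
          simp only [smul_mul_smul_comm, tprod_mul_tprod, map_smul, reindex_tprod]
          rfl)

theorem rotateTensorPower_tprod (f : Fin p → A) :
    rotateTensorPower p F A (tprod F f) = tprod F fun i => f ((finRotate p).symm i) := by
  rw [rotateTensorPower, AlgEquiv.ofLinearEquiv_apply]
  exact reindex_tprod (s := fun _ : Fin p => A) (finRotate p) f

theorem repr_rotateTensorPower (b : Module.Basis ι F A) (x : ⨂[F] _ : Fin p, A) (f : Fin p → ι) :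
    (Basis.piTensorProduct fun _ : Fin p => b).repr (rotateTensorPower p F A x) f =
      (Basis.piTensorProduct fun _ : Fin p => b).repr x (f ∘ finRotate p) := by
  induction x using PiTensorProduct.induction_on with
  | add x y hx hy => simp [hx, hy]
  | smul_tprod r g =>
    simp only [map_smul, rotateTensorPower_tprod, Finsupp.smul_apply,
      Basis.piTensorProduct_repr_tprod_apply, Function.comp_apply]
    refine congrArg (r • ·) ((Equiv.prod_comp (finRotate p) fun i =>
      b.repr (g ((finRotate p).symm i)) (f i)).symm.trans ?_)
    exact Finset.prod_congr rfl fun i _ => by rw [Equiv.symm_apply_apply]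

/-- The linear map from the tensor power that reads off the diagonal coordinates. -/
noncomputable def diagonalCoord [Fintype ι] (b : Module.Basis ι F A) (θ : A →+* B) :
    (⨂[F] _ : Fin p, A) →ₗ[F] B :=
  ∑ i, ((Basis.piTensorProduct fun _ : Fin p => b).coord fun _ => i).smulRight (θ (b i))

variable {p} [Fintype ι] (b : Module.Basis ι F A) {θ : A →+* B}

theorem diagonalCoord_apply (x : ⨂[F] _ : Fin p, A) : diagonalCoord p b θ x =
    ∑ i, (Basis.piTensorProduct fun _ : Fin p => b).repr x (fun _ => i) • θ (b i) := by
  simp [diagonalCoord]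

theorem sum_repr_pow_smul (hθ : ∀ (c : F) (a : A), θ (c • a) = c ^ p • θ a) (a : A) :
    ∑ i, b.repr a i ^ p • θ (b i) = θ a := by
  simp only [← hθ, ← map_sum, b.sum_repr]

theorem diagonalCoord_tprod_const (hθ : ∀ (c : F) (a : A), θ (c • a) = c ^ p • θ a) (a : A) :
    diagonalCoord p b θ (tprod F fun _ => a) = θ a := by
  simp [diagonalCoord_apply, sum_repr_pow_smul b hθ]

theorem repr_mul_const [Fact p.Prime] [CharP F p] {x y : ⨂[F] _ : Fin p, A}
    (hx : rotateTensorPower p F A x = x) (hy : rotateTensorPower p F A y = y) (k : ι) :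
    (Basis.piTensorProduct fun _ : Fin p => b).repr (x * y) (fun _ => k) =
      ∑ i, ∑ j, (Basis.piTensorProduct fun _ : Fin p => b).repr x (fun _ => i) *
        (Basis.piTensorProduct fun _ : Fin p => b).repr y (fun _ => j) *
          b.repr (b i * b j) k ^ p := by
  classical
  set β := Basis.piTensorProduct fun _ : Fin p => b with hβ
  have hxf (f) : β.repr x (f ∘ finRotate p) = β.repr x f := by
    rw [← repr_rotateTensorPower, hx]
  have hyf (f) : β.repr y (f ∘ finRotate p) = β.repr y f := by
    rw [← repr_rotateTensorPower, hy]
  have hmul : x * y = ∑ f, ∑ g, (β.repr x f * β.repr y g) •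
      tprod F fun i => b (f i) * b (g i) := by
    conv_lhs => rw [← β.sum_repr x, ← β.sum_repr y, Finset.sum_mul_sum]
    refine Finset.sum_congr rfl fun f _ => Finset.sum_congr rfl fun g _ => ?_
    rw [smul_mul_smul_comm, hβ, Basis.piTensorProduct_apply, Basis.piTensorProduct_apply,
      tprod_mul_tprod]
    rfl
  let h (q : Fin p → ι × ι) : F := β.repr x (Prod.fst ∘ q) * β.repr y (Prod.snd ∘ q) *
    ∏ i, b.repr (b (q i).1 * b (q i).2) k
  have hh (q) : h (q ∘ finRotate p) = h q := by
    simp only [h, ← Function.comp_assoc, hxf, hyf]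
    congr 1
    exact Equiv.prod_comp (finRotate p) fun i => b.repr (b (q i).1 * b (q i).2) k
  calc β.repr (x * y) (fun _ => k) = ∑ f : Fin p → ι, ∑ g : Fin p → ι, h fun i => (f i, g i) := by
        rw [hmul]
        simp [h, hβ, Function.comp_def]
    _ = ∑ q, h q := by
        rw [← Fintype.sum_prod_type']
        exact (Equiv.arrowProdEquivProdArrow (Fin p) (fun _ => ι) (fun _ => ι)).symm.sum_comp h
    _ = ∑ q : ι × ι, h fun _ => q := sum_pi_eq_sum_const h hh
    _ = _ := by simp [Fintype.sum_prod_type, h, Function.comp_def]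

theorem diagonalCoord_mul [Fact p.Prime] [CharP F p]
    (hθ : ∀ (c : F) (a : A), θ (c • a) = c ^ p • θ a) {x y : ⨂[F] _ : Fin p, A}
    (hx : rotateTensorPower p F A x = x) (hy : rotateTensorPower p F A y = y) :
    diagonalCoord p b θ (x * y) = diagonalCoord p b θ x * diagonalCoord p b θ y := by
  simp only [diagonalCoord_apply, repr_mul_const b hx hy, Finset.sum_mul_sum, Finset.sum_smul]
  rw [Finset.sum_comm]
  refine Finset.sum_congr rfl fun i _ => ?_
  rw [Finset.sum_comm]
  refine Finset.sum_congr rfl fun j _ => ?_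
  rw [smul_mul_smul_comm, ← θ.map_mul, ← sum_repr_pow_smul b hθ (b i * b j), Finset.smul_sum]
  simp only [mul_smul]

/-- In characteristic `p`, any algebra spanned by the image of a Frobenius-semilinear ring
homomorphism from `A` is a quotient of the rotation invariants of the `p`-th tensor power
of `A`. -/
theorem exists_surjective_rotate_invariants [Fact p.Prime] [CharP F p] [FiniteDimensional F A]
    (hθ : ∀ (c : F) (a : A), θ (c • a) = c ^ p • θ a)
    (hspan : Submodule.span F (Set.range θ) = ⊤) :
    ∃ π : AlgHom.equalizer (rotateTensorPower p F A).toAlgHom (AlgHom.id F _) →ₐ[F] B,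
      Function.Surjective π := by
  let b := Module.finBasis F A
  let S := AlgHom.equalizer (rotateTensorPower p F A).toAlgHom (AlgHom.id F _)
  let π : S →ₐ[F] B := AlgHom.ofLinearMap (diagonalCoord p b θ ∘ₗ S.val.toLinearMap)
    ((diagonalCoord_tprod_const b hθ 1).trans θ.map_one)
    (fun x y => diagonalCoord_mul b hθ x.2 y.2)
  refine ⟨π, (LinearMap.range_eq_top (f := π.toLinearMap)).1 (top_unique ?_)⟩
  rw [← hspan, Submodule.span_le]
  rintro _ ⟨a, rfl⟩
  exact ⟨⟨tprod F fun _ => a, rotateTensorPower_tprod p _⟩, diagonalCoord_tprod_const b hθ a⟩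

end FrobeniusTwist

/-- In characteristic `p`, if the `p`-th tensor power of `A` is split, then so is every central
simple algebra spanned by the image of a Frobenius-semilinear ring homomorphism from `A`. -/
theorem isSplitAlg_of_frobenius_semilinear {p : ℕ} [Fact p.Prime] {F A B : Type} [Field F]
    [CharP F p] [Ring A] [Algebra F A] [FiniteDimensional F A] [Ring B] [Algebra F B]
    [Algebra.IsCentral F B] [IsSimpleRing B] {θ : A →+* B}
    (hθ : ∀ (c : F) (a : A), θ (c • a) = c ^ p • θ a)
    (hspan : Submodule.span F (Set.range θ) = ⊤) (hexp : IsSplitAlg F (⨂[F] _ : Fin p, A)) :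
    IsSplitAlg F B := by
  obtain ⟨π, hπ⟩ := exists_surjective_rotate_invariants hθ hspan
  obtain ⟨n, -, ⟨ε₀⟩⟩ := hexp
  let ε : (⨂[F] _ : Fin p, A) ≃ₐ[F] Module.End F (Fin n → F) := ε₀.trans Matrix.toLinAlgEquiv'
  let σ := rotateTensorPower p F A
  obtain ⟨T, hT⟩ := (ε.symm.trans (σ.trans ε)).eq_linearEquivConjAlgEquiv
  have hfix (x) : σ x = x ↔ T.toLinearMap * ε x = ε x * T.toLinearMap := by
    have h := AlgEquiv.congr_fun hT (ε x)
    rw [← ε.injective.eq_iff]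
    simp only [AlgEquiv.trans_apply, AlgEquiv.symm_apply_apply] at h
    rw [h, LinearEquiv.conjAlgEquiv_apply, ← LinearMap.comp_assoc,
      LinearEquiv.comp_toLinearMap_symm_eq]
    rfl
  let f : Subalgebra.centralizer F {T.toLinearMap} →ₐ[F]
      AlgHom.equalizer σ.toAlgHom (AlgHom.id F _) :=
    ((ε.symm : _ →ₐ[F] _).comp (Subalgebra.val _)).codRestrict _ fun s =>
      (hfix _).2 (by simpa using (Subalgebra.mem_centralizer_iff F).1 s.2 _ rfl)
  refine isSplitAlg_of_surjective_centralizer T.toLinearMap (π.comp f) (hπ.comp fun x => ?_)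
  refine ⟨⟨ε x, ?_⟩, Subtype.ext (ε.symm_apply_apply _)⟩
  rw [Subalgebra.mem_centralizer_iff]
  intro w hw
  rw [Set.mem_singleton_iff.1 hw]
  exact (hfix _).1 x.2

/-- For a purely inseparable extension `K/F` with `K ^ p ⊆ F` and the
Frobenius homomorphism `φ : K → F`, the composite `Frob_{K/F} ∘ r_{K/F}` is trivial on
`Br_p(F)`: for every central simple `F`-algebra `A` of exponent dividing `p`, the
Frobenius twist `F ⊗[K] (K ⊗[F] A)` is split. -/
theorem statement16 (p : ℕ) (hp : p.Prime) (F : Type) [Field F] [CharP F p]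
    (K : Type) [Field K] [Algebra F K] [IsPurelyInseparable F K]
    (hKp : ∀ z : K, z ^ p ∈ (algebraMap F K).range)
    (φ : K →+* F) (hφ : ∀ z : K, algebraMap F K (φ z) = z ^ p)
    (A : Type) [Ring A] [Algebra F A] (hA : IsCSA F A)
    (hexp : IsSplitAlg F (⨂[F] _ : Fin p, A)) :
    letI : Algebra K F := φ.toAlgebra
    IsSplitAlg F (F ⊗[K] (K ⊗[F] A)) := by
  let : Algebra K F := φ.toAlgebra
  have : Fact p.Prime := ⟨hp⟩
  obtain ⟨_, _, _⟩ := hA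
  have hφF (c : F) : φ (algebraMap F K c) = c ^ p :=
    (algebraMap F K).injective (by rw [hφ, map_pow])
  have hc : Algebra.IsCentral K (K ⊗[F] A) := isCentral_baseChange
  have hs : IsSimpleRing (K ⊗[F] A) := isSimpleRing_baseChange
  have hc' : Algebra.IsCentral F (F ⊗[K] (K ⊗[F] A)) := isCentral_baseChange
  have hs' : IsSimpleRing (F ⊗[K] (K ⊗[F] A)) := isSimpleRing_baseChange
  have hmove (l : F) (z : K) (a : A) :
      (l ⊗ₜ[K] (z ⊗ₜ[F] a) : F ⊗[K] (K ⊗[F] A)) = (l * φ z) • (1 ⊗ₜ[K] (1 ⊗ₜ[F] a)) := by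
    rw [TensorProduct.smul_tmul', smul_eq_mul, mul_one,
      show z ⊗ₜ[F] a = z • ((1 : K) ⊗ₜ[F] a) by rw [TensorProduct.smul_tmul', smul_eq_mul, mul_one],
      ← TensorProduct.smul_tmul, Algebra.smul_def, mul_comm]
    rfl
  let θ : A →+* F ⊗[K] (K ⊗[F] A) :=
    (Algebra.TensorProduct.includeRight (R := K) (A := F) (B := K ⊗[F] A)).toRingHom.comp
      (Algebra.TensorProduct.includeRight (R := F) (A := K) (B := A)).toRingHom
  have hθa (a : A) : θ a = 1 ⊗ₜ[K] (1 ⊗ₜ[F] a) := rfl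
  refine isSplitAlg_of_frobenius_semilinear (θ := θ) (fun c a => ?_) ?_ hexp
  · rw [hθa, hθa, ← TensorProduct.smul_tmul, Algebra.smul_def, mul_one, hmove, one_mul, hφF]
  · refine top_unique fun x _ => ?_
    induction x with
    | zero => exact zero_mem _
    | add x y hx hy => exact add_mem (hx trivial) (hy trivial)
    | tmul l y =>
      induction y with
      | zero => rw [TensorProduct.tmul_zero]; exact zero_mem _
      | add x y hx hy => rw [TensorProduct.tmul_add]; exact add_mem (hx trivial) (hy trivial)
      | tmul z a =>
        rw [hmove]
        exact Submodule.smul_mem _ _ (Submodule.subset_span ⟨a, rfl⟩)
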